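/- (Strict monotonicity of the Black–Scholes price in the square-root of total variance.) For fixed S, K > 0, the function F : (0, ∞) → ℝ defined by F(v) = S Φ(log(S/K)/v + v/2) − K Φ(log(S/K)/v − v/2) is strictly increasing on (0, ∞), where Φ is the standard normal CDF. -/

import Mathlib

open Real Filter Set

/-- Standard normal CDF. -/
noncomputable def stdNormalCDF (x : ℝ) : ℝ :=
  (Real.sqrt (2 * Real.pi))⁻¹ * ∫ t in Set.Iic x, Real.exp (-t ^ 2 / 2)

/-- Standard normal density. -/
noncomputable def stdNormalPDF (x : ℝ) : ℝ :=
  (Real.sqrt (2 * Real.pi))⁻¹ * Real.exp (-x ^ 2 / 2)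

/-- d₊ in the Black–Scholes formula. -/
noncomputable def dPlus (S σ r δ K τ : ℝ) : ℝ :=
  (Real.log (S / K) + (r - δ) * τ) / (σ * Real.sqrt τ) + σ * Real.sqrt τ / 2

/-- d₋ in the Black–Scholes formula. -/
noncomputable def dMinus (S σ r δ K τ : ℝ) : ℝ :=
  (Real.log (S / K) + (r - δ) * τ) / (σ * Real.sqrt τ) - σ * Real.sqrt τ / 2

/-- Black–Scholes call price. -/
noncomputable def bsCall (S σ r δ K τ : ℝ) : ℝ :=
  S * Real.exp (-δ * τ) * stdNormalCDF (dPlus S σ r δ K τ)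
    - K * Real.exp (-r * τ) * stdNormalCDF (dMinus S σ r δ K τ)

lemma stdNormalCDF_hasDerivAt (x : ℝ) : HasDerivAt stdNormalCDF (stdNormalPDF x) x := by
  have hc : Continuous (fun t : ℝ => Real.exp (-t ^ 2 / 2)) := by fun_prop
  have hi : MeasureTheory.Integrable (fun t : ℝ => Real.exp (-t ^ 2 / 2)) := by
    have h := integrable_exp_neg_mul_sq (b := 1 / 2) (by norm_num)
    refine h.congr (Filter.Eventually.of_forall fun t => ?_)
    show Real.exp _ = Real.exp _
    congr 1
    ring
  have h1 : HasDerivAt (fun u => ∫ t in (0 : ℝ)..u, Real.exp (-t ^ 2 / 2))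
      (Real.exp (-x ^ 2 / 2)) x :=
    intervalIntegral.integral_hasDerivAt_right (hc.intervalIntegrable _ _)
      (hc.stronglyMeasurableAtFilter _ _) hc.continuousAt
  have h2 := (h1.const_add (∫ t in Set.Iic (0 : ℝ), Real.exp (-t ^ 2 / 2))).const_mul
    (Real.sqrt (2 * Real.pi))⁻¹
  refine h2.congr_of_eventuallyEq (Filter.Eventually.of_forall fun u => ?_)
  have h3 := intervalIntegral.integral_Iic_sub_Iic (a := 0) (b := u)
    hi.integrableOn hi.integrableOn
  show (Real.sqrt (2 * Real.pi))⁻¹ * _ = (Real.sqrt (2 * Real.pi))⁻¹ * _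
  rw [← h3]
  ring

lemma bs_hasDerivAt (S K : ℝ) (hS : 0 < S) (hK : 0 < K) (v : ℝ) (hv : 0 < v) :
    HasDerivAt (fun v => S * stdNormalCDF (Real.log (S / K) / v + v / 2)
        - K * stdNormalCDF (Real.log (S / K) / v - v / 2))
      (S * stdNormalPDF (Real.log (S / K) / v + v / 2)) v := by
  have hv0 : v ≠ 0 := hv.ne'
  have key : S * stdNormalPDF (Real.log (S / K) / v + v / 2)
      = K * stdNormalPDF (Real.log (S / K) / v - v / 2) := by
    have hSK : S = K * Real.exp (Real.log (S / K)) := by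
      rw [Real.exp_log (div_pos hS hK)]
      field_simp
    generalize Real.log (S / K) = L at hSK ⊢
    unfold stdNormalPDF
    have : -(L / v - v / 2) ^ 2 / 2 = L + -(L / v + v / 2) ^ 2 / 2 := by
      field_simp
      ring
    rw [this, Real.exp_add, hSK]
    ring
  generalize Real.log (S / K) = L at key ⊢
  have hL : HasDerivAt (fun v : ℝ => L / v) (-L / v ^ 2) v := by
    have h := (hasDerivAt_inv hv0).const_mul L
    simp only [← div_eq_mul_inv] at h
    refine h.congr_deriv ?_
    field_simp
  have hh : HasDerivAt (fun v : ℝ => v / 2) (1 / 2) v := (hasDerivAt_id v).div_const 2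
  have hp := ((stdNormalCDF_hasDerivAt _).comp v (hL.add hh)).const_mul S
  have hm := ((stdNormalCDF_hasDerivAt _).comp v (hL.sub hh)).const_mul K
  refine (hp.sub hm).congr_deriv ?_
  simp only [Pi.add_apply, Pi.sub_apply]
  linear_combination (-L / v ^ 2 - 1 / 2) * key

/-- The zero-rate Black–Scholes price, as a function of the square root of total
variance, is strictly increasing on `(0, ∞)`. -/
theorem stmt_13 (S K : ℝ) (hS : 0 < S) (hK : 0 < K) :
    StrictMonoOn
      (fun v => S * stdNormalCDF (Real.log (S / K) / v + v / 2)
        - K * stdNormalCDF (Real.log (S / K) / v - v / 2))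
      (Set.Ioi 0) := by
  apply strictMonoOn_of_deriv_pos (convex_Ioi 0)
  · intro v hv
    exact (bs_hasDerivAt S K hS hK v hv).continuousAt.continuousWithinAt
  · intro v hv
    rw [interior_Ioi] at hv
    rw [(bs_hasDerivAt S K hS hK v hv).deriv]
    unfold stdNormalPDF
    positivity
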